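/- For every integer n ≥ 1, the ring ℤ/nℤ is a UJ# ring if and only if n is a power of 2 (i.e., n = 2^k for some k ≥ 0). -/

import Mathlib

/-- `J#(R)`: the set of elements `z` such that `z ^ n` lies in the Jacobson radical
(the intersection of the maximal left ideals) for some `n ≥ 1`. -/
def Jsharp (R : Type*) [Ring R] : Set R :=
  {z : R | ∃ n : ℕ, 1 ≤ n ∧ z ^ n ∈ Ideal.jacobson (⊥ : Ideal R)}

/-- A ring is a `UJ#` ring if `u - 1 ∈ J#(R)` for every unit `u`. -/
def IsUJsharp (R : Type*) [Ring R] : Prop :=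
  ∀ u : Rˣ, ((u : R) - 1) ∈ Jsharp R

/-- In a commutative Artinian ring, `J#(R)` is the set of nilpotent elements. -/
theorem mem_Jsharp_iff_isNilpotent {R : Type*} [CommRing R] [IsArtinianRing R] {z : R} :
    z ∈ Jsharp R ↔ IsNilpotent z := by
  constructor
  · rintro ⟨m, -, hm⟩
    rw [IsArtinianRing.jacobson_eq_radical] at hm
    exact mem_nilradical.mp (Ideal.mem_radical_of_pow_mem hm)
  · rintro ⟨m, hm⟩
    exact ⟨m + 1, Nat.le_add_left 1 m, by rw [pow_succ, hm, zero_mul]; exact zero_mem _⟩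

theorem isUJsharp_zmod_two_pow (k : ℕ) : IsUJsharp (ZMod (2 ^ k)) := by
  intro u
  rw [mem_Jsharp_iff_isNilpotent]
  rcases Nat.eq_zero_or_pos k with rfl | hk
  · exact ⟨1, Subsingleton.elim (α := ZMod 1) _ _⟩
  · have hodd : Odd (u : ZMod (2 ^ k)).val :=
      (Nat.coprime_pow_right_iff hk _ 2).mp (ZMod.val_coe_unit_coprime u) |>.odd_of_right
    obtain ⟨m, hm⟩ := hodd
    have hu : (u : ZMod (2 ^ k)) - 1 = 2 * m := by
      rw [← ZMod.natCast_zmod_val (u : ZMod (2 ^ k)), hm]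
      push_cast
      ring
    refine ⟨k, ?_⟩
    have htwo : (2 : ZMod (2 ^ k)) ^ k = 0 := by
      exact_mod_cast ZMod.natCast_self (2 ^ k)
    rw [hu, mul_pow, htwo, zero_mul]

theorem zmod_isUJsharp_iff_pow_two (n : ℕ) (hn : 1 ≤ n) :
    IsUJsharp (ZMod n) ↔ ∃ k : ℕ, n = 2 ^ k := by
  constructor
  · intro h
    have : NeZero n := ⟨by omega⟩
    obtain ⟨m, hm⟩ := mem_Jsharp_iff_isNilpotent.mp (h (-1))
    have htwo : ((2 ^ m : ℕ) : ZMod n) = 0 := by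
      have hneg : ((-1 : (ZMod n)ˣ) : ZMod n) - 1 = -2 := by
        push_cast
        ring
      rw [hneg, neg_pow] at hm
      push_cast
      exact (isUnit_one.neg.pow m).mul_right_eq_zero.mp hm
    obtain ⟨k, -, hk⟩ := (Nat.dvd_prime_pow Nat.prime_two).mp
      ((ZMod.natCast_eq_zero_iff _ _).mp htwo)
    exact ⟨k, hk⟩
  · rintro ⟨k, rfl⟩
    exact isUJsharp_zmod_two_pow k
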